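/- Suppose that for some c₀ > 0 there is a C² function φ₀ on ℝ solving φ₀'' + c₀φ₀' + f(φ₀) = 0 with φ₀(−∞) = 1 > φ₀ > φ₀(+∞) = 0, where f ∈ C¹([0,1]) with f(0) = f(1) = 0. Then there exists c* > 0 such that the same boundary value problem has a solution for c = c* and no solution for any c < c*. -/

import Mathlib

open Filter Topology

/-- A traveling-front profile with speed `c` for the reaction `f`: a `C²` solution of
`φ'' + cφ' + f(φ) = 0` on `ℝ` with `φ(−∞) = 1 > φ(z) > φ(+∞) = 0`. -/
def IsFrontProfile (f : ℝ → ℝ) (c : ℝ) (φ : ℝ → ℝ) : Prop :=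
  ContDiff ℝ 2 φ ∧
  (∀ z : ℝ, deriv (deriv φ) z + c * deriv φ z + f (φ z) = 0) ∧
  Filter.Tendsto φ Filter.atBot (nhds 1) ∧
  Filter.Tendsto φ Filter.atTop (nhds 0) ∧
  (∀ z : ℝ, 0 < φ z ∧ φ z < 1)

/-- Time-reversed front, written as a first order system. -/
structure RFront (g : ℝ → ℝ) (c : ℝ) (ψ q : ℝ → ℝ) : Prop where
  d1 : ∀ z, HasDerivAt ψ (q z) z
  d2 : ∀ z, HasDerivAt q (c * q z - g (ψ z)) z
  lb : Tendsto ψ atBot (𝓝 0)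
  lt : Tendsto ψ atTop (𝓝 1)
  pos : ∀ z, 0 < ψ z
  lt1 : ∀ z, ψ z < 1

theorem IsFrontProfile.toRFront {f g : ℝ → ℝ} {c : ℝ} {φ : ℝ → ℝ} (h : IsFrontProfile f c φ)
    (hfg : ∀ u ∈ Set.Icc (0:ℝ) 1, g u = f u) :
    RFront g c (fun z => φ (-z)) (fun z => - deriv φ (-z)) := by
  obtain ⟨h1, h2, h3, h4, h5⟩ := h
  have hd : Differentiable ℝ φ := h1.differentiable (by norm_num)
  have hdd : Differentiable ℝ (deriv φ) := by
    have : ContDiff ℝ (1+1) φ := by simpa [one_add_one_eq_two] using h1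
    exact (contDiff_succ_iff_deriv.1 this).2.2.differentiable (by norm_num)
  refine ⟨fun z => ?_, fun z => ?_, h4.comp tendsto_neg_atBot_atTop,
    h3.comp tendsto_neg_atTop_atBot, fun z => (h5 _).1, fun z => (h5 _).2⟩
  · have := (hd (-z)).hasDerivAt.comp z (hasDerivAt_neg z)
    simpa [Function.comp_def] using this
  · have := ((hdd (-z)).hasDerivAt.comp z (hasDerivAt_neg z)).neg
    have e := h2 (-z)
    rw [hfg _ ⟨(h5 _).1.le, (h5 _).2.le⟩]
    refine this.congr_deriv ?_
    linarith

theorem RFront.toFront {f g : ℝ → ℝ} {c : ℝ} {ψ q : ℝ → ℝ} (h : RFront g c ψ q)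
    (hg : Continuous g)
    (hfg : ∀ u ∈ Set.Icc (0:ℝ) 1, g u = f u) :
    IsFrontProfile f c (fun z => ψ (-z)) := by
  have e1 : ∀ z, HasDerivAt (fun z => ψ (-z)) (- q (-z)) z := fun z => by
    simpa [Function.comp_def] using (h.d1 (-z)).comp z (hasDerivAt_neg z)
  have e2 : ∀ z, HasDerivAt (fun z => - q (-z)) (c * q (-z) - g (ψ (-z))) z := fun z => by
    have := ((h.d2 (-z)).comp z (hasDerivAt_neg z)).neg
    refine this.congr_deriv ?_
    ring
  have f1 : deriv (fun z => ψ (-z)) = fun z => - q (-z) := funext fun z => (e1 z).deriv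
  have f2 : deriv (fun z => - q (-z)) = fun z => c * q (-z) - g (ψ (-z)) :=
    funext fun z => (e2 z).deriv
  have cq : Continuous q := continuous_iff_continuousAt.2 fun z => (h.d2 z).continuousAt
  have cψ : Continuous ψ := continuous_iff_continuousAt.2 fun z => (h.d1 z).continuousAt
  refine ⟨?_, ?_, h.lt.comp tendsto_neg_atBot_atTop, h.lb.comp tendsto_neg_atTop_atBot,
    fun z => ⟨h.pos _, h.lt1 _⟩⟩
  · have : ContDiff ℝ (1+1) (fun z => ψ (-z)) := by
      rw [contDiff_succ_iff_deriv]
      refine ⟨fun z => (e1 z).differentiableAt, by simp, ?_⟩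
      rw [f1, contDiff_one_iff_deriv]
      refine ⟨fun z => (e2 z).differentiableAt, ?_⟩
      rw [f2]
      fun_prop
    simpa [one_add_one_eq_two] using this
  · intro z
    rw [f1, f2, ← hfg _ ⟨(h.pos _).le, (h.lt1 _).le⟩]
    ring

theorem exists_seq_deriv_zero {ψ q : ℝ → ℝ} {l : ℝ} (h : ∀ z, HasDerivAt ψ (q z) z)
    (hl : Tendsto ψ atTop (𝓝 l)) :
    ∃ ξ : ℕ → ℝ, Tendsto ξ atTop atTop ∧ Tendsto (fun n => q (ξ n)) atTop (𝓝 0) := by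
  have : ∀ n : ℕ, ∃ x ∈ Set.Ioo (n:ℝ) (n+1), q x = (ψ (n+1) - ψ n) / ((n+1) - n) := fun n =>
    exists_hasDerivAt_eq_slope ψ q (by linarith)
      (fun z _ => (h z).continuousAt.continuousWithinAt) (fun x _ => h x)
  choose ξ h1 h2 using this
  refine ⟨ξ, tendsto_atTop_mono (fun n => (h1 n).1.le) tendsto_natCast_atTop_atTop, ?_⟩
  simp_rw [h2]
  have a := hl.comp (tendsto_natCast_atTop_atTop (R := ℝ))
  have b := hl.comp (tendsto_atTop_add_const_right atTop (1:ℝ)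
    (tendsto_natCast_atTop_atTop (R := ℝ)))
  simpa using b.sub a

theorem exists_seq_deriv_zero' {ψ q : ℝ → ℝ} {l : ℝ} (h : ∀ z, HasDerivAt ψ (q z) z)
    (hl : Tendsto ψ atBot (𝓝 l)) :
    ∃ ξ : ℕ → ℝ, Tendsto ξ atTop atBot ∧ Tendsto (fun n => q (ξ n)) atTop (𝓝 0) := by
  obtain ⟨ξ, h1, h2⟩ := exists_seq_deriv_zero (ψ := fun z => ψ (-z)) (q := fun z => - q (-z))
    (fun z => by simpa [Function.comp_def] using (h (-z)).comp z (hasDerivAt_neg z))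
    (hl.comp tendsto_neg_atTop_atBot)
  exact ⟨fun n => - ξ n, tendsto_neg_atTop_atBot.comp h1, by simpa using h2.neg⟩

section
variable {g : ℝ → ℝ} {c : ℝ} {ψ q : ℝ → ℝ}

/-- the energy -/
noncomputable def En (g ψ q : ℝ → ℝ) (z : ℝ) : ℝ := q z ^ 2 / 2 + ∫ x in (0:ℝ)..(ψ z), g x

theorem RFront.hasDerivAt_En (h : RFront g c ψ q) (hg : Continuous g) (z : ℝ) :
    HasDerivAt (En g ψ q) (c * q z ^ 2) z := by
  have hF : HasDerivAt (fun u => ∫ x in (0:ℝ)..u, g x) (g (ψ z)) (ψ z) :=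
    intervalIntegral.integral_hasDerivAt_right (hg.intervalIntegrable _ _)
      (hg.stronglyMeasurableAtFilter _ _) hg.continuousAt
  have := (((h.d2 z).pow 2).div_const 2).add (hF.comp z (h.d1 z))
  refine this.congr_deriv ?_
  simp; ring

theorem cont_prim (hg : Continuous g) : Continuous (fun u => ∫ x in (0:ℝ)..u, g x) :=
  intervalIntegral.continuous_primitive (fun a b => hg.intervalIntegrable a b) 0

theorem RFront.En_seq_top (h : RFront g c ψ q) (hg : Continuous g) :
    ∃ ξ : ℕ → ℝ, Tendsto ξ atTop atTop ∧
      Tendsto (fun n => En g ψ q (ξ n)) atTop (𝓝 (∫ x in (0:ℝ)..1, g x)) := by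
  obtain ⟨ξ, h1, h2⟩ := exists_seq_deriv_zero h.d1 h.lt
  refine ⟨ξ, h1, ?_⟩
  have a := ((cont_prim hg).tendsto 1).comp (h.lt.comp h1)
  have := ((h2.pow 2).div_const 2).add a
  simpa [En] using this

theorem RFront.En_seq_bot (h : RFront g c ψ q) (hg : Continuous g) :
    ∃ ξ : ℕ → ℝ, Tendsto ξ atTop atBot ∧ Tendsto (fun n => En g ψ q (ξ n)) atTop (𝓝 0) := by
  obtain ⟨ξ, h1, h2⟩ := exists_seq_deriv_zero' h.d1 h.lb
  refine ⟨ξ, h1, ?_⟩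
  have a := ((cont_prim hg).tendsto 0).comp (h.lb.comp h1)
  have := ((h2.pow 2).div_const 2).add a
  simpa [En] using this

/-- no front for `c ≤ 0` when the integral of `g` is positive -/
theorem RFront.c_pos (h : RFront g c ψ q) (hg : Continuous g) (hI : 0 < ∫ x in (0:ℝ)..1, g x) :
    0 < c := by
  by_contra hc
  push Not at hc
  have hm : Antitone (En g ψ q) := antitone_of_hasDerivAt_nonpos (h.hasDerivAt_En hg)
    (fun _ => mul_nonpos_of_nonpos_of_nonneg hc (sq_nonneg _))
  obtain ⟨ξ, a1, a2⟩ := h.En_seq_top hg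
  obtain ⟨η, b1, b2⟩ := h.En_seq_bot hg
  have : (∫ x in (0:ℝ)..1, g x) ≤ 0 := by
    refine le_of_tendsto_of_tendsto a2 b2 ?_
    filter_upwards [a1.eventually_ge_atTop 0, b1.eventually_le_atBot 0] with n x y
    exact hm (y.trans x)
  linarith

theorem RFront.mono_En (h : RFront g c ψ q) (hg : Continuous g) (hc : 0 < c) :
    Monotone (En g ψ q) := monotone_of_hasDerivAt_nonneg (h.hasDerivAt_En hg)
    (fun z => mul_nonneg hc.le (sq_nonneg _))

theorem RFront.En_top (h : RFront g c ψ q) (hg : Continuous g) (hc : 0 < c) :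
    Tendsto (En g ψ q) atTop (𝓝 (∫ x in (0:ℝ)..1, g x)) := by
  obtain ⟨ξ, h1, h2⟩ := h.En_seq_top hg
  exact (tendsto_iff_tendsto_subseq_of_monotone (h.mono_En hg hc) h1).2 h2

theorem RFront.En_bot (h : RFront g c ψ q) (hg : Continuous g) (hc : 0 < c) :
    Tendsto (En g ψ q) atBot (𝓝 0) := by
  obtain ⟨ξ, h1, h2⟩ := h.En_seq_bot hg
  have hm : Monotone (fun z => - En g ψ q (-z)) := fun a b hab =>
    neg_le_neg (h.mono_En hg hc (neg_le_neg hab))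
  have := (tendsto_iff_tendsto_subseq_of_monotone (φ := fun n => - ξ n) (l := (0:ℝ)) hm
    (tendsto_neg_atBot_atTop.comp h1)).2 (by simpa [Function.comp_def] using h2.neg)
  have := (this.comp tendsto_neg_atBot_atTop).neg
  simpa [Function.comp_def] using this

theorem RFront.q_top (h : RFront g c ψ q) (hg : Continuous g) (hc : 0 < c) :
    Tendsto q atTop (𝓝 0) := by
  have a := ((cont_prim hg).tendsto 1).comp h.lt
  have b := ((h.En_top hg hc).sub a).const_mul 2
  have b : Tendsto (fun z => q z ^ 2) atTop (𝓝 0) := by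
    simp only [sub_self, mul_zero] at b
    refine b.congr fun z => ?_
    simp [En]; ring
  have := b.sqrt
  simp only [Real.sqrt_sq_eq_abs, Real.sqrt_zero] at this
  exact (tendsto_zero_iff_abs_tendsto_zero _).2 this

theorem RFront.q_bot (h : RFront g c ψ q) (hg : Continuous g) (hc : 0 < c) :
    Tendsto q atBot (𝓝 0) := by
  have a := ((cont_prim hg).tendsto 0).comp h.lb
  have b := ((h.En_bot hg hc).sub a).const_mul 2
  have b : Tendsto (fun z => q z ^ 2) atBot (𝓝 0) := by
    simp only [intervalIntegral.integral_same, sub_self, mul_zero] at b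
    refine b.congr fun z => ?_
    simp [En]; ring
  have := b.sqrt
  simp only [Real.sqrt_sq_eq_abs, Real.sqrt_zero] at this
  exact (tendsto_zero_iff_abs_tendsto_zero _).2 this

/-- no point is an equilibrium -/
theorem RFront.not_eq (h : RFront g c ψ q) {L : NNReal} (hL : LipschitzWith L g) (z : ℝ)
    (h1 : q z = 0) : g (ψ z) ≠ 0 := by
  intro h2
  have hlip : ∃ K, LipschitzWith K (fun x : ℝ × ℝ => (x.2, c * x.2 - g x.1)) := by
    have l2 : LipschitzWith (1:NNReal) (fun x : ℝ × ℝ => x.2) := LipschitzWith.prod_snd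
    have l1 := hL.comp (LipschitzWith.prod_fst (α := ℝ) (β := ℝ))
    have l3 := (lipschitzWith_smul c).comp l2
    exact ⟨_, l2.prodMk (l3.sub l1)⟩
  obtain ⟨K, hK⟩ := hlip
  have := ODE_solution_unique_univ (v := fun _ x => (x.2, c * x.2 - g x.1)) (s := fun _ => Set.univ)
    (K := K) (f := fun t => (ψ t, q t)) (g := fun _ => (ψ z, q z)) (t₀ := z)
    (fun t => hK.lipschitzOnWith)
    (fun t => ⟨(h.d1 t).prodMk (h.d2 t), trivial⟩)
    (fun t => ⟨by
      have : ((q z, c * q z - g (ψ z)) : ℝ × ℝ) = 0 := by simp [h1, h2]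
      simp only [this]
      exact hasDerivAt_const _ _, trivial⟩) rfl
  have e : ψ = fun _ => ψ z := by
    funext t
    exact congrArg Prod.fst (congrFun this t)
  have := h.lb
  rw [e] at this
  have := tendsto_nhds_unique this tendsto_const_nhds
  linarith [h.pos z]

theorem RFront.ne_of_crit (h : RFront g c ψ q) {L : NNReal} (hL : LipschitzWith L g)
    (hc : 0 < c) {z y : ℝ} (h1 : q z = 0) (hy : y < z) : ψ y ≠ ψ z := by
  intro e
  have hg := hL.continuous
  have hm := h.mono_En hg hc
  have hq : ∀ x ∈ Set.Ioo y z, q x = 0 := by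
    intro x hx
    have hconst : ∀ x ∈ Set.Ioo y z, En g ψ q x = En g ψ q z := by
      intro x hx
      apply le_antisymm (hm hx.2.le)
      refine le_trans ?_ (hm hx.1.le)
      simp only [En, h1, e]
      nlinarith [sq_nonneg (q y)]
    have h0 : HasDerivAt (En g ψ q) 0 x := by
      refine (hasDerivAt_const x (En g ψ q z)).congr_of_eventuallyEq ?_
      filter_upwards [Ioo_mem_nhds hx.1 hx.2] with w hw using hconst w hw
    have := h0.unique (h.hasDerivAt_En hg x)
    have : q x ^ 2 = 0 := by
      rcases mul_eq_zero.1 this.symm with h | h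
      · linarith
      · exact h
    simpa using this
  obtain ⟨x, hx⟩ := exists_between hy
  have h0 : HasDerivAt q 0 x := by
    refine (hasDerivAt_const x (0:ℝ)).congr_of_eventuallyEq ?_
    filter_upwards [Ioo_mem_nhds hx.1 hx.2] with w hw using hq w hw
  have := h0.unique (h.d2 x)
  rw [hq x hx] at this
  exact h.not_eq hL x (hq x hx) (by linarith)

theorem RFront.cont (h : RFront g c ψ q) : Continuous ψ :=
  continuous_iff_continuousAt.2 fun z => (h.d1 z).continuousAt

theorem RFront.contq (h : RFront g c ψ q) : Continuous q :=
  continuous_iff_continuousAt.2 fun z => (h.d2 z).continuousAt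

theorem RFront.lt_of_crit (h : RFront g c ψ q) {L : NNReal} (hL : LipschitzWith L g)
    (hc : 0 < c) {z y : ℝ} (h1 : q z = 0) (hy : y < z) : ψ y < ψ z := by
  by_contra hlt
  push Not at hlt
  obtain ⟨x, hx1, hx2⟩ := ((h.lb.eventually_lt_const (h.pos z)).and (eventually_le_atBot y)).exists
  obtain ⟨w, hw, hw'⟩ := intermediate_value_Icc hx2 (h.cont.continuousOn) ⟨hx1.le, hlt⟩
  exact h.ne_of_crit hL hc h1 (hw.2.trans_lt hy) hw'

theorem RFront.mono (h : RFront g c ψ q) {L : NNReal} (hL : LipschitzWith L g)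
    (hc : 0 < c) : Monotone ψ := by
  intro a b hab
  by_contra hlt
  push Not at hlt
  have hab : a < b := lt_of_le_of_ne hab (by rintro rfl; exact lt_irrefl _ hlt)
  obtain ⟨d, hd1, hd2⟩ :=
    ((h.lt.eventually_const_lt (h.lt1 b)).and (eventually_gt_atTop b)).exists
  obtain ⟨x, hx, hmin⟩ := isCompact_Icc.exists_isMinOn (s := Set.Icc a d)
    ⟨b, hab.le, hd2.le⟩ h.cont.continuousOn
  have hb : ψ x ≤ ψ b := hmin (show b ∈ Set.Icc a d from ⟨hab.le, hd2.le⟩)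
  have hxa : a < x := lt_of_le_of_ne hx.1 (by rintro rfl; linarith)
  have hxd : x < d := lt_of_le_of_ne hx.2 (by rintro rfl; linarith)
  have hloc : IsLocalMin ψ x := hmin.isLocalMin (Icc_mem_nhds hxa hxd)
  have h0 := hloc.hasDerivAt_eq_zero (h.d1 x)
  have := h.lt_of_crit hL hc h0 hxa
  have h2 : ψ x ≤ ψ a := hmin (show a ∈ Set.Icc a d from ⟨le_rfl, by linarith⟩)
  linarith

theorem RFront.q_pos (h : RFront g c ψ q) {L : NNReal} (hL : LipschitzWith L g)
    (hc : 0 < c) (z : ℝ) : 0 < q z := by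
  have hnn : ∀ z, 0 ≤ q z := fun z => by
    rw [← (h.d1 z).deriv]
    exact (h.mono hL hc).deriv_nonneg
  refine lt_of_le_of_ne (hnn z) fun h0 => ?_
  have hloc : IsLocalMin q z := Eventually.of_forall fun x => by rw [← h0]; exact hnn x
  have := hloc.hasDerivAt_eq_zero (h.d2 z)
  rw [← h0] at this
  exact h.not_eq hL z h0.symm (by linarith)

end
/-- Phase-plane profile. -/
structure PP (g : ℝ → ℝ) (c : ℝ) (p : ℝ → ℝ) : Prop where
  cont : Continuous p
  zero : ∀ u, u ∉ Set.Ioo (0:ℝ) 1 → p u = 0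
  pos : ∀ u ∈ Set.Ioo (0:ℝ) 1, 0 < p u
  deriv : ∀ u, HasDerivAt (fun u => p u ^ 2) (2 * (c * p u - g u)) u

theorem PP.nonneg {g : ℝ → ℝ} {c : ℝ} {p : ℝ → ℝ} (h : PP g c p) (u : ℝ) : 0 ≤ p u := by
  by_cases hu : u ∈ Set.Ioo (0:ℝ) 1
  · exact (h.pos u hu).le
  · exact (h.zero u hu).ge

theorem RFront.toPP {g : ℝ → ℝ} {c : ℝ} {ψ q : ℝ → ℝ} (h : RFront g c ψ q) {L : NNReal}
    (hL : LipschitzWith L g) (hg0 : ∀ u, u ∉ Set.Ioo (0:ℝ) 1 → g u = 0) (hc : 0 < c) :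
    ∃ p, PP g c p := by
  classical
  have hg := hL.continuous
  have hsm : StrictMono ψ := strictMono_of_hasDerivAt_pos h.d1 (h.q_pos hL hc)
  have hsurj : ∀ u ∈ Set.Ioo (0:ℝ) 1, ∃ z, ψ z = u := by
    intro u hu
    obtain ⟨a, ha⟩ := (h.lb.eventually_lt_const hu.1).exists
    obtain ⟨b, hb⟩ := (h.lt.eventually_const_lt hu.2).exists
    exact mem_range_of_exists_le_of_exists_ge h.cont ⟨a, ha.le⟩ ⟨b, hb.le⟩
  have : ∃ Y : ℝ → ℝ, ∀ u ∈ Set.Ioo (0:ℝ) 1, ψ (Y u) = u := by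
    choose! Y hY using hsurj
    exact ⟨Y, hY⟩
  obtain ⟨Y, hY⟩ := this
  have hYψ : ∀ z, Y (ψ z) = z := fun z => hsm.injective (hY _ ⟨h.pos z, h.lt1 z⟩)
  have hYm : StrictMonoOn Y (Set.Ioo 0 1) := by
    intro a ha b hb hab
    rw [← hsm.lt_iff_lt, hY a ha, hY b hb]; exact hab
  have hYc : ∀ u ∈ Set.Ioo (0:ℝ) 1, ContinuousAt Y u := by
    intro u hu
    refine hYm.continuousAt_of_image_mem_nhds (Ioo_mem_nhds hu.1 hu.2) ?_
    have : Y '' Set.Ioo 0 1 = Set.univ := by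
      ext z
      simp only [Set.mem_image, Set.mem_univ, iff_true]
      exact ⟨ψ z, ⟨h.pos z, h.lt1 z⟩, hYψ z⟩
    rw [this]; exact univ_mem
  have hYd : ∀ u ∈ Set.Ioo (0:ℝ) 1, HasDerivAt Y (q (Y u))⁻¹ u := by
    intro u hu
    refine HasDerivAt.of_local_left_inverse (hYc u hu) (h.d1 _) (h.q_pos hL hc _).ne' ?_
    filter_upwards [Ioo_mem_nhds hu.1 hu.2] with w hw using hY w hw
  set p : ℝ → ℝ := fun u => if u ∈ Set.Ioo (0:ℝ) 1 then q (Y u) else 0 with hp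
  have hp1 : ∀ u ∈ Set.Ioo (0:ℝ) 1, p u = q (Y u) := fun u hu => if_pos hu
  have hp0 : ∀ u, u ∉ Set.Ioo (0:ℝ) 1 → p u = 0 := fun u hu => if_neg hu
  have hpc : Continuous p := by
    rw [continuous_iff_continuousAt]
    intro u
    rcases le_or_gt u 0 with hu0 | hu0
    · have hpu : p u = 0 := hp0 u (fun hh => absurd hh.1 (not_lt.2 hu0))
      rw [ContinuousAt, hpu, Metric.tendsto_nhds]
      intro ε hε
      obtain ⟨M, hM⟩ := eventually_atBot.1 (Metric.tendsto_nhds.1 (h.q_bot hg hc) ε hε)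
      filter_upwards [Iio_mem_nhds (show u < ψ M from lt_of_le_of_lt hu0 (h.pos M))] with w hw
      by_cases hw' : w ∈ Set.Ioo (0:ℝ) 1
      · rw [hp1 w hw']
        refine hM _ (le_of_lt ?_)
        rw [← hsm.lt_iff_lt, hY w hw']; exact hw
      · rw [hp0 w hw', dist_self]; exact hε
    · rcases le_or_gt 1 u with hu1 | hu1
      · have hpu : p u = 0 := hp0 u (fun hh => absurd hh.2 (not_lt.2 hu1))
        rw [ContinuousAt, hpu, Metric.tendsto_nhds]
        intro ε hε
        obtain ⟨M, hM⟩ := eventually_atTop.1 (Metric.tendsto_nhds.1 (h.q_top hg hc) ε hε)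
        filter_upwards [Ioi_mem_nhds (show ψ M < u from lt_of_lt_of_le (h.lt1 M) hu1)] with w hw
        by_cases hw' : w ∈ Set.Ioo (0:ℝ) 1
        · rw [hp1 w hw']
          refine hM _ (le_of_lt ?_)
          rw [← hsm.lt_iff_lt, hY w hw']; exact hw
        · rw [hp0 w hw', dist_self]; exact hε
      · have : ContinuousAt (fun u => q (Y u)) u :=
          ContinuousAt.comp (g := q) h.contq.continuousAt (hYc u ⟨hu0, hu1⟩)
        refine this.congr ?_
        filter_upwards [Ioo_mem_nhds hu0 hu1] with w hw using (hp1 w hw).symm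
  have hd1 : ∀ u ∈ Set.Ioo (0:ℝ) 1, HasDerivAt (fun u => p u ^ 2) (2 * (c * p u - g u)) u := by
    intro u hu
    have a := ((h.d2 (Y u)).comp u (hYd u hu)).pow 2
    have b : HasDerivAt (fun u => p u ^ 2) _ u := a.congr_of_eventuallyEq (by
      filter_upwards [Ioo_mem_nhds hu.1 hu.2] with w hw
      simp [hp1 w hw])
    refine b.congr_deriv ?_
    have := (h.q_pos hL hc (Y u)).ne'
    rw [hp1 u hu, hY u hu]
    simp
    field_simp
  have hd2 : ∀ u, u ∉ Set.Icc (0:ℝ) 1 → HasDerivAt (fun u => p u ^ 2) (2 * (c * p u - g u)) u := by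
    intro u hu
    have hu' : u ∉ Set.Ioo (0:ℝ) 1 := fun hh => hu (Set.Ioo_subset_Icc_self hh)
    rw [hp0 u hu', hg0 u hu']
    simp only [mul_zero, sub_zero]
    refine (hasDerivAt_const u (0:ℝ)).congr_of_eventuallyEq ?_
    filter_upwards [isClosed_Icc.isOpen_compl.mem_nhds hu] with w hw
    rw [hp0 w fun hh => hw (Set.Ioo_subset_Icc_self hh)]
    simp
  refine ⟨p, hpc, hp0, fun u hu => by rw [hp1 u hu]; exact h.q_pos hL hc _, fun u => ?_⟩
  have hcont : Continuous (fun u => 2 * (c * p u - g u)) := by fun_prop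
  have hI : ∀ u, ∫ x in (0:ℝ)..u, 2 * (c * p x - g x) = p u ^ 2 := by
    intro u
    have := MeasureTheory.integral_eq_of_hasDerivAt_off_countable (fun u => p u ^ 2)
      (fun u => 2 * (c * p u - g u)) (a := 0) (b := u) (s := {0, 1})
      (Set.toFinite _).countable (hpc.pow 2).continuousOn (fun x hx => ?_)
      (hcont.intervalIntegrable _ _)
    · rw [this, hp0 0 (by simp)]; simp
    · by_cases hu : x ∈ Set.Ioo (0:ℝ) 1
      · exact hd1 x hu
      · refine hd2 x fun hh => ?_
        have hx2 := hx.2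
        simp only [Set.mem_insert_iff, Set.mem_singleton_iff, not_or] at hx2
        exact hu ⟨lt_of_le_of_ne hh.1 (Ne.symm hx2.1), lt_of_le_of_ne hh.2 hx2.2⟩
  have := intervalIntegral.integral_hasDerivAt_right (a := 0) (b := u)
    (hcont.intervalIntegrable _ _) (hcont.stronglyMeasurableAtFilter _ _) hcont.continuousAt
  exact this.congr_of_eventuallyEq (Eventually.of_forall fun x => (hI x).symm)

/-- first-crossing lemma -/
theorem pos_of_deriv_nonneg {d : ℝ → ℝ} {a b : ℝ} (hd : ContinuousOn d (Set.Icc a b))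
    (hab : a ≤ b) (ha : 0 < d a)
    (h : ∀ x ∈ Set.Ioo a b, 0 < d x → ∃ d', 0 ≤ d' ∧ HasDerivAt d d' x) : 0 < d b := by
  by_contra hb
  push Not at hb
  have hcl : IsCompact (Set.Icc a b ∩ d ⁻¹' Set.Iic 0) :=
    isCompact_Icc.of_isClosed_subset (hd.preimage_isClosed_of_isClosed isClosed_Icc isClosed_Iic)
      Set.inter_subset_left
  obtain ⟨x, ⟨hx1, hx2⟩, hx3⟩ := hcl.exists_isLeast ⟨b, ⟨hab, le_rfl⟩, hb⟩
  have hx2 : d x ≤ 0 := hx2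
  have hax : a < x := lt_of_le_of_ne hx1.1 (by rintro rfl; linarith)
  have hpos : ∀ y ∈ Set.Ioo a x, 0 < d y := by
    intro y hy
    by_contra hn
    push Not at hn
    exact absurd (hx3 ⟨⟨hy.1.le, hy.2.le.trans hx1.2⟩, hn⟩) (not_le.2 hy.2)
  have hder : ∀ y ∈ Set.Ioo a x, ∃ d', 0 ≤ d' ∧ HasDerivAt d d' y := fun y hy =>
    h y ⟨hy.1, hy.2.trans_le hx1.2⟩ (hpos y hy)
  have hm : MonotoneOn d (Set.Icc a x) := by
    refine monotoneOn_of_deriv_nonneg (convex_Icc a x)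
      (hd.mono (Set.Icc_subset_Icc_right hx1.2)) ?_ ?_
    · rw [interior_Icc]
      intro y hy
      obtain ⟨d', _, hd'⟩ := hder y hy
      exact hd'.differentiableAt.differentiableWithinAt
    · rw [interior_Icc]
      intro y hy
      obtain ⟨d', h0, hd'⟩ := hder y hy
      rw [hd'.deriv]; exact h0
  have := hm ⟨le_rfl, hax.le⟩ ⟨hax.le, le_rfl⟩ hax.le
  linarith

section
variable {g : ℝ → ℝ} {c c' : ℝ} {p p' : ℝ → ℝ}

theorem PP.compare (h : PP g c p) (h' : PP g c' p') (hc' : 0 ≤ c') (hcc : c ≤ c') (u : ℝ) :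
    p' u ≤ p u := by
  by_contra hlt
  push Not at hlt
  have hu : u ∈ Set.Ioo (0:ℝ) 1 := by
    by_contra hu
    rw [h.zero u hu, h'.zero u hu] at hlt
    exact lt_irrefl _ hlt
  have key := pos_of_deriv_nonneg (d := fun u => p' u ^ 2 - p u ^ 2) (a := u) (b := 1)
    (((h'.cont.pow 2).sub (h.cont.pow 2)).continuousOn) hu.2.le
    (by nlinarith [h.nonneg u]) (fun x hx hpos => by
      refine ⟨_, ?_, (h'.deriv x).sub (h.deriv x)⟩
      have h1 : p x ≤ p' x := by
        by_contra hh
        push Not at hh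
        nlinarith [h'.nonneg x]
      nlinarith [h.nonneg x, mul_le_mul_of_nonneg_right hcc (h.nonneg x),
        mul_le_mul_of_nonneg_left h1 hc'])
  simp [h.zero 1 (by simp), h'.zero 1 (by simp)] at key

theorem PP.hasDerivAt (h : PP g c p) {u : ℝ} (hu : u ∈ Set.Ioo (0:ℝ) 1) :
    HasDerivAt p (c - g u / p u) u := by
  have hp := h.pos u hu
  have a := (h.deriv u).sqrt (by positivity)
  have b : HasDerivAt p _ u := a.congr_of_eventuallyEq (Eventually.of_forall fun x => by
    simp [Real.sqrt_sq (h.nonneg x)])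
  refine b.congr_deriv ?_
  rw [Real.sqrt_sq hp.le]
  field_simp

theorem PP.le_right (h : PP g c p) {L K : ℝ} (hL : ∀ u ∈ Set.Ioo (0:ℝ) 1, |g u| ≤ L * (1 - u))
    (hL0 : 0 ≤ L) (hc : 0 ≤ c) (hK : c + L + 1 ≤ K) (u : ℝ) (hu : u ∈ Set.Ioo (0:ℝ) 1) :
    p u ≤ K * (1 - u) := by
  by_contra hlt
  push Not at hlt
  have key := pos_of_deriv_nonneg (d := fun u => p u - K * (1 - u)) (a := u) (b := 1)
    ((h.cont.sub (by fun_prop)).continuousOn) hu.2.le (by linarith) (fun x hx hpos => by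
      have hx' : x ∈ Set.Ioo (0:ℝ) 1 := ⟨hu.1.trans hx.1, hx.2⟩
      refine ⟨_, ?_, (h.hasDerivAt hx').sub (((hasDerivAt_id x).const_sub 1).const_mul K)⟩
      have hp := h.pos x hx'
      have hg := (le_abs_self _).trans (hL x hx')
      have : g x / p x ≤ K := by
        rw [div_le_iff₀ hp]
        have h1 : 0 < 1 - x := by linarith [hx.2]
        have h2 : L * (1 - x) ≤ K * (1 - x) := by nlinarith
        have h3 : p x ≤ K * p x := by nlinarith
        linarith
      linarith)
  simp [h.zero 1 (by simp)] at key

theorem PP.le_left (h : PP g c p) {L K : ℝ} (hL : ∀ u ∈ Set.Ioo (0:ℝ) 1, |g u| ≤ L * u)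
    (hL0 : 0 ≤ L) (hc : 0 ≤ c) (hK : c + L + 1 ≤ K) (u : ℝ) (hu : u ∈ Set.Ioo (0:ℝ) 1) :
    p u ≤ K * u := by
  by_contra hlt
  push Not at hlt
  have key := pos_of_deriv_nonneg (d := fun x => p (-x) - K * (-x)) (a := -u) (b := 0)
    (((h.cont.comp continuous_neg).sub (by fun_prop)).continuousOn) (by linarith [hu.1])
    (by simp only [neg_neg]; linarith) (fun x hx hpos => by
      have hx' : -x ∈ Set.Ioo (0:ℝ) 1 := ⟨by linarith [hx.2], by linarith [hx.1, hu.2]⟩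
      refine ⟨_, ?_, ((h.hasDerivAt hx').comp x (hasDerivAt_neg x)).sub
        ((hasDerivAt_neg x).const_mul K)⟩
      have hp := h.pos _ hx'
      have hg := (neg_le_abs _).trans (hL _ hx')
      have : - g (-x) / p (-x) ≤ L := by
        rw [div_le_iff₀ hp]
        have h1 : 0 < -x := by linarith [hx.2]
        have h3 : -x ≤ K * (-x) := by nlinarith
        have h4 : -x ≤ p (-x) := by linarith
        nlinarith
      rw [neg_div] at this
      linarith)
  simp [h.zero 0 (by simp)] at key

end
section
variable {g : ℝ → ℝ} {c : ℝ} {p : ℝ → ℝ}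

theorem PP.toRFront (h : PP g c p) {K : ℝ} (hK : 0 < K)
    (hl : ∀ u ∈ Set.Ioo (0:ℝ) 1, p u ≤ K * u)
    (hr : ∀ u ∈ Set.Ioo (0:ℝ) 1, p u ≤ K * (1 - u)) : ∃ ψ q, RFront g c ψ q := by
  set T : ℝ → ℝ := fun u => ∫ x in (1/2:ℝ)..u, (p x)⁻¹ with hT
  have hci : ∀ u ∈ Set.Ioo (0:ℝ) 1, ContinuousAt (fun x => (p x)⁻¹) u := fun u hu =>
    h.cont.continuousAt.inv₀ (h.pos u hu).ne'
  have hTd : ∀ u ∈ Set.Ioo (0:ℝ) 1, HasDerivAt T (p u)⁻¹ u := by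
    intro u hu
    have hsub : Set.uIcc (1/2:ℝ) u ⊆ Set.Ioo 0 1 :=
      Set.OrdConnected.uIcc_subset Set.ordConnected_Ioo (by norm_num) hu
    have hco : ContinuousOn (fun x => (p x)⁻¹) (Set.Ioo 0 1) := fun x hx =>
      (hci x hx).continuousWithinAt
    exact intervalIntegral.integral_hasDerivAt_right (hco.mono hsub).intervalIntegrable
      (hco.stronglyMeasurableAtFilter isOpen_Ioo u hu) (hci u hu)
  have hTm : StrictMonoOn T (Set.Ioo 0 1) := by
    refine strictMonoOn_of_deriv_pos (convex_Ioo _ _)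
      (fun u hu => (hTd u hu).continuousAt.continuousWithinAt) ?_
    rw [interior_Ioo]
    intro u hu
    rw [(hTd u hu).deriv]
    exact inv_pos.2 (h.pos u hu)
  have hm1 : MonotoneOn (fun u => T u + K⁻¹ * Real.log (1 - u)) (Set.Ioo 0 1) := by
    have hd : ∀ u ∈ Set.Ioo (0:ℝ) 1, HasDerivAt (fun u => T u + K⁻¹ * Real.log (1 - u))
        ((p u)⁻¹ + K⁻¹ * (-1 / (1 - u))) u := fun u hu =>
      (hTd u hu).add ((((hasDerivAt_id u).const_sub 1).log (by
        have := hu.2; simp only [id]; linarith)).const_mul K⁻¹)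
    refine monotoneOn_of_deriv_nonneg (convex_Ioo _ _)
      (fun u hu => (hd u hu).continuousAt.continuousWithinAt) ?_ ?_ <;> rw [interior_Ioo]
    · exact fun u hu => (hd u hu).differentiableAt.differentiableWithinAt
    · intro u hu
      rw [(hd u hu).deriv]
      have h1 : 0 < 1 - u := by linarith [hu.2]
      have := inv_anti₀ (h.pos u hu) (hr u hu)
      have e : K⁻¹ * (-1 / (1 - u)) = - (K * (1 - u))⁻¹ := by field_simp
      rw [e]; linarith
  have hm2 : MonotoneOn (fun u => T u - K⁻¹ * Real.log u) (Set.Ioo 0 1) := by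
    have hd : ∀ u ∈ Set.Ioo (0:ℝ) 1, HasDerivAt (fun u => T u - K⁻¹ * Real.log u)
        ((p u)⁻¹ - K⁻¹ * u⁻¹) u := fun u hu =>
      (hTd u hu).sub ((Real.hasDerivAt_log hu.1.ne').const_mul K⁻¹)
    refine monotoneOn_of_deriv_nonneg (convex_Ioo _ _)
      (fun u hu => (hd u hu).continuousAt.continuousWithinAt) ?_ ?_ <;> rw [interior_Ioo]
    · exact fun u hu => (hd u hu).differentiableAt.differentiableWithinAt
    · intro u hu
      rw [(hd u hu).deriv]
      have := inv_anti₀ (h.pos u hu) (hl u hu)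
      rw [mul_inv] at this
      linarith
  have hhalf : (1/2:ℝ) ∈ Set.Ioo (0:ℝ) 1 := by norm_num
  have hThalf : T (1/2) = 0 := by simp [hT]
  have hlog : Real.log (1/2) ≤ 0 := Real.log_nonpos (by norm_num) (by norm_num)
  -- large values
  have hbig : ∀ z : ℝ, ∃ u ∈ Set.Ioo (0:ℝ) 1, z ≤ T u := by
    intro z
    set s := Real.exp (-(K * |z|)) with hs
    have hs0 : 0 < s := Real.exp_pos _
    have hs1 : s ≤ 1 := Real.exp_le_one_iff.2 (by have := abs_nonneg z; nlinarith)
    have hu : 1 - s / 2 ∈ Set.Ioo (0:ℝ) 1 := ⟨by linarith, by linarith⟩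
    refine ⟨1 - s/2, hu, ?_⟩
    have := hm1 hhalf hu (by linarith)
    simp only [hThalf] at this
    have e : Real.log (1 - (1 - s/2)) = -(K * |z|) + Real.log (1/2) := by
      rw [show 1 - (1 - s/2) = s * (1/2) by ring, Real.log_mul hs0.ne' (by norm_num), hs,
        Real.log_exp]
    rw [e, show (1 - 1/2 : ℝ) = 1/2 by norm_num] at this
    have e2 : K⁻¹ * (-(K * |z|) + Real.log (1/2)) = - |z| + K⁻¹ * Real.log (1/2) := by
      field_simp
    rw [e2] at this
    linarith [le_abs_self z]
  have hsmall : ∀ z : ℝ, ∃ u ∈ Set.Ioo (0:ℝ) 1, T u ≤ z := by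
    intro z
    set s := Real.exp (-(K * |z|)) with hs
    have hs0 : 0 < s := Real.exp_pos _
    have hs1 : s ≤ 1 := Real.exp_le_one_iff.2 (by have := abs_nonneg z; nlinarith)
    have hu : s / 2 ∈ Set.Ioo (0:ℝ) 1 := ⟨by linarith, by linarith⟩
    refine ⟨s/2, hu, ?_⟩
    have := hm2 hu hhalf (by linarith)
    simp only [hThalf] at this
    have e : Real.log (s/2) = -(K * |z|) + Real.log (1/2) := by
      rw [show s/2 = s * (1/2) by ring, Real.log_mul hs0.ne' (by norm_num), hs,
        Real.log_exp]
    rw [e] at this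
    have e2 : K⁻¹ * (-(K * |z|) + Real.log (1/2)) = - |z| + K⁻¹ * Real.log (1/2) := by
      field_simp
    rw [e2] at this
    linarith [neg_abs_le z]
  have hsurj : ∀ z : ℝ, ∃ u ∈ Set.Ioo (0:ℝ) 1, T u = z := by
    intro z
    obtain ⟨a, ha, ha'⟩ := hsmall z
    obtain ⟨b, hb, hb'⟩ := hbig z
    have hco : ContinuousOn T (Set.Ioo 0 1) := fun u hu =>
      (hTd u hu).continuousAt.continuousWithinAt
    exact isPreconnected_Ioo.intermediate_value ha hb hco ⟨ha', hb'⟩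
  choose ψ hψ hTψ using hsurj
  have hψT : ∀ u ∈ Set.Ioo (0:ℝ) 1, ψ (T u) = u := fun u hu =>
    hTm.injOn (hψ _) hu (hTψ _)
  have hψm : StrictMono ψ := by
    intro a b hab
    rw [← hTm.lt_iff_lt (hψ a) (hψ b), hTψ, hTψ]; exact hab
  have hψc : ∀ z, ContinuousAt ψ z := by
    intro z
    refine (hψm.strictMonoOn Set.univ).continuousAt_of_image_mem_nhds univ_mem ?_
    have : ψ '' Set.univ = Set.Ioo 0 1 := by
      ext u
      simp only [Set.image_univ, Set.mem_range]
      exact ⟨fun ⟨z, hz⟩ => hz ▸ hψ z, fun hu => ⟨T u, hψT u hu⟩⟩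
    rw [this]; exact Ioo_mem_nhds (hψ z).1 (hψ z).2
  have hψd : ∀ z, HasDerivAt ψ (p (ψ z)) z := by
    intro z
    have := HasDerivAt.of_local_left_inverse (hψc z) (hTd _ (hψ z))
      (inv_pos.2 (h.pos _ (hψ z))).ne' (Eventually.of_forall hTψ)
    rwa [inv_inv] at this
  refine ⟨ψ, fun z => p (ψ z), hψd, fun z => ?_, ?_, ?_, fun z => (hψ z).1, fun z => (hψ z).2⟩
  · have := (h.hasDerivAt (hψ z)).comp z (hψd z)
    refine this.congr_deriv ?_
    have := (h.pos _ (hψ z)).ne'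
    field_simp
  · rw [tendsto_order]
    refine ⟨fun a ha => Eventually.of_forall fun z => ha.trans (hψ z).1, fun a ha => ?_⟩
    have hu : min a (1/2) ∈ Set.Ioo (0:ℝ) 1 :=
      ⟨lt_min ha (by norm_num), (min_le_right _ _).trans_lt (by norm_num)⟩
    filter_upwards [eventually_lt_atBot (T (min a (1/2)))] with z hz
    refine lt_of_lt_of_le ?_ (min_le_left a (1/2))
    rw [← hTm.lt_iff_lt (hψ z) hu, hTψ]; exact hz
  · rw [tendsto_order]
    refine ⟨fun a ha => ?_, fun a ha => Eventually.of_forall fun z => (hψ z).2.trans ha⟩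
    have hu : max a (1/2) ∈ Set.Ioo (0:ℝ) 1 :=
      ⟨lt_of_lt_of_le (by norm_num) (le_max_right _ _), max_lt ha (by norm_num)⟩
    filter_upwards [eventually_gt_atTop (T (max a (1/2)))] with z hz
    refine lt_of_le_of_lt (le_max_left a (1/2)) ?_
    rw [← hTm.lt_iff_lt hu (hψ z), hTψ]; exact hz

theorem PP.integral_eq (h : PP g c p) (hg : Continuous g) (u : ℝ) :
    ∫ x in (0:ℝ)..u, 2 * (c * p x - g x) = p u ^ 2 := by
  have hp := h.cont
  have hcont : Continuous (fun u => 2 * (c * p u - g u)) := by fun_prop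
  rw [intervalIntegral.integral_eq_sub_of_hasDerivAt (fun x _ => h.deriv x)
    (hcont.intervalIntegrable _ _), h.zero 0 (by simp)]
  simp

theorem PP.integral_pos (h : PP g c p) (hg : Continuous g) (hc : 0 < c) :
    0 < ∫ x in (0:ℝ)..1, g x := by
  have h1 := h.integral_eq hg 1
  have hp := h.cont
  rw [h.zero 1 (by simp), intervalIntegral.integral_const_mul, intervalIntegral.integral_sub
    ((by fun_prop : Continuous fun x => c * p x).intervalIntegrable _ _)
    (hg.intervalIntegrable _ _), intervalIntegral.integral_const_mul] at h1
  have : 0 < ∫ x in (0:ℝ)..1, p x :=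
    intervalIntegral.intervalIntegral_pos_of_pos_on (hp.intervalIntegrable _ _)
      (fun x hx => h.pos x hx) one_pos
  have := mul_pos hc this
  nlinarith

/-- limit of phase plane profiles -/
theorem PP.limit (hg : Continuous g) (hg0 : ∀ u, u ∉ Set.Ioo (0:ℝ) 1 → g u = 0)
    {L : ℝ} (hL0 : 0 ≤ L)
    (hLr : ∀ u ∈ Set.Ioo (0:ℝ) 1, |g u| ≤ L * (1 - u))
    {cn : ℕ → ℝ} {pn : ℕ → ℝ → ℝ} (hn : ∀ n, PP g (cn n) (pn n))
    (hpos : ∀ n, 0 < cn n) (hanti : Antitone cn) (hlim : Tendsto cn atTop (𝓝 c)) :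
    ∃ p, PP g c p := by
  set K := cn 0 + L + 1 with hK
  have hK0 : 0 ≤ K := by have := hpos 0; linarith
  have hbd : ∀ n u, pn n u ≤ K := by
    intro n u
    by_cases hu : u ∈ Set.Ioo (0:ℝ) 1
    · have := (hn n).le_right hLr hL0 (hpos n).le (K := K)
        (by have := hanti (Nat.zero_le n); linarith) u hu
      nlinarith [hu.1]
    · rw [(hn n).zero u hu]; exact hK0
  have hmono : ∀ u, Monotone (fun n => pn n u) := fun u m n hmn =>
    (hn n).compare (hn m) (hpos m).le (hanti hmn) u
  set p : ℝ → ℝ := fun u => ⨆ n, pn n u with hp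
  have hpl : ∀ u, Tendsto (fun n => pn n u) atTop (𝓝 (p u)) := fun u =>
    tendsto_atTop_ciSup (hmono u) ⟨K, by rintro _ ⟨n, rfl⟩; exact hbd n u⟩
  have hpm : Measurable p := measurable_of_tendsto_metrizable
    (fun n => (hn n).cont.measurable) (tendsto_pi_nhds.2 hpl)
  have hp0 : ∀ u, 0 ≤ p u := fun u => ge_of_tendsto' (hpl u) fun n => (hn n).nonneg u
  have hpK : ∀ u, p u ≤ K := fun u => le_of_tendsto' (hpl u) fun n => hbd n u
  have hgc : ∀ a b : ℝ, IntervalIntegrable (fun x => 2 * (cn 0 * K + |g x|)) MeasureTheory.volume a b :=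
    fun a b => (by fun_prop : Continuous fun x => 2 * (cn 0 * K + |g x|)).intervalIntegrable _ _
  have hmeas : Measurable (fun x => 2 * (c * p x - g x)) :=
    ((hpm.const_mul c).sub hg.measurable).const_mul 2
  have hc0 : 0 ≤ c := ge_of_tendsto' hlim fun n => (hpos n).le
  have hcc : c ≤ cn 0 := le_of_tendsto' hlim fun n => hanti (Nat.zero_le n)
  have hbound : ∀ (c' y x : ℝ), 0 ≤ c' → c' ≤ cn 0 → 0 ≤ y → y ≤ K →
      ‖2 * (c' * y - g x)‖ ≤ 2 * (cn 0 * K + |g x|) := by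
    intro c' y x h1 h2 h3 h4
    have h5 : c' * y ≤ cn 0 * K := mul_le_mul h2 h4 h3 (h1.trans h2)
    have h6 := mul_nonneg h1 h3
    rw [Real.norm_eq_abs, abs_le]
    constructor <;> linarith [le_abs_self (g x), neg_abs_le (g x)]
  have hint : ∀ a b : ℝ, IntervalIntegrable (fun x => 2 * (c * p x - g x))
      MeasureTheory.volume a b := fun a b =>
    (hgc a b).mono_fun hmeas.aestronglyMeasurable (Eventually.of_forall fun x =>
      (hbound c (p x) x hc0 hcc (hp0 x) (hpK x)).trans (le_abs_self _))
  have hI : ∀ u, ∫ x in (0:ℝ)..u, 2 * (c * p x - g x) = p u ^ 2 := by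
    intro u
    have h1 : Tendsto (fun n => ∫ x in (0:ℝ)..u, 2 * (cn n * pn n x - g x)) atTop
        (𝓝 (∫ x in (0:ℝ)..u, 2 * (c * p x - g x))) := by
      refine intervalIntegral.tendsto_integral_filter_of_dominated_convergence
        (fun x => 2 * (cn 0 * K + |g x|)) ?_ ?_ (hgc _ _) ?_
      · refine Eventually.of_forall fun n => Continuous.aestronglyMeasurable ?_
        have := (hn n).cont
        fun_prop
      · exact Eventually.of_forall fun n => Eventually.of_forall fun x _ =>
          hbound _ _ x (hpos n).le (hanti (Nat.zero_le n)) ((hn n).nonneg x) (hbd n x)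
      · exact Eventually.of_forall fun x _ =>
          ((hlim.mul (hpl x)).sub_const _).const_mul 2
    have h2 : Tendsto (fun n => ∫ x in (0:ℝ)..u, 2 * (cn n * pn n x - g x)) atTop
        (𝓝 (p u ^ 2)) := by
      simp_rw [fun n => (hn n).integral_eq hg u]
      exact (hpl u).pow 2
    exact tendsto_nhds_unique h1 h2
  have hpc : Continuous p := by
    have h1 := intervalIntegral.continuous_primitive hint 0
    have h2 : p = fun u => √(∫ x in (0:ℝ)..u, 2 * (c * p x - g x)) := by
      funext u
      rw [hI u, Real.sqrt_sq (hp0 u)]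
    rw [h2]
    exact h1.sqrt
  have hcont : Continuous (fun u => 2 * (c * p u - g u)) := by fun_prop
  refine ⟨p, hpc, fun u hu => ?_, fun u hu => ?_, fun u => ?_⟩
  · exact tendsto_nhds_unique (hpl u) (by simp [fun n => (hn n).zero u hu])
  · exact lt_of_lt_of_le ((hn 0).pos u hu)
      (ge_of_tendsto' (hpl u) fun n => hmono u (Nat.zero_le n))
  · have := intervalIntegral.integral_hasDerivAt_right (a := 0) (b := u)
      (hcont.intervalIntegrable _ _) (hcont.stronglyMeasurableAtFilter _ _) hcont.continuousAt
    exact this.congr_of_eventuallyEq (Eventually.of_forall fun x => (hI x).symm)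

end

theorem exists_minimal_front_speed (f : ℝ → ℝ) (hf : ContDiffOn ℝ 1 f (Set.Icc 0 1))
    (hf0 : f 0 = 0) (hf1 : f 1 = 0) (c₀ : ℝ) (hc₀ : 0 < c₀)
    (φ₀ : ℝ → ℝ) (h₀ : IsFrontProfile f c₀ φ₀) :
    ∃ cs : ℝ, 0 < cs ∧ (∃ φ : ℝ → ℝ, IsFrontProfile f cs φ) ∧
      ∀ c : ℝ, c < cs → ¬ ∃ φ : ℝ → ℝ, IsFrontProfile f c φ := by
  obtain ⟨L, hL⟩ := hf.exists_lipschitzOnWith one_ne_zero (convex_Icc 0 1) isCompact_Icc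
  set g : ℝ → ℝ := Set.IccExtend (zero_le_one (α := ℝ)) (fun x => f x) with hgdef
  have hgf : ∀ u ∈ Set.Icc (0:ℝ) 1, g u = f u := fun u hu =>
    Set.IccExtend_of_mem zero_le_one _ hu
  have hgL : LipschitzWith L g := by
    have := hL.to_restrict.comp (LipschitzWith.projIcc (zero_le_one (α := ℝ)))
    rw [mul_one] at this
    exact this
  have hg := hgL.continuous
  have hg0 : ∀ u, u ∉ Set.Ioo (0:ℝ) 1 → g u = 0 := by
    intro u hu
    rcases le_or_gt u 0 with h | h
    · rw [hgdef, Set.IccExtend_of_le_left _ _ h]; exact hf0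
    · have : 1 ≤ u := by
        by_contra h1
        exact hu ⟨h, not_le.1 h1⟩
      rw [hgdef, Set.IccExtend_of_right_le _ _ this]; exact hf1
  have hLl : ∀ u ∈ Set.Ioo (0:ℝ) 1, |g u| ≤ L * u := by
    intro u hu
    have := hgL.dist_le_mul u 0
    rwa [hg0 0 (by simp), Real.dist_eq, Real.dist_eq, sub_zero, sub_zero,
      abs_of_pos hu.1] at this
  have hLr : ∀ u ∈ Set.Ioo (0:ℝ) 1, |g u| ≤ L * (1 - u) := by
    intro u hu
    have := hgL.dist_le_mul u 1
    rwa [hg0 1 (by simp), Real.dist_eq, Real.dist_eq, sub_zero, abs_sub_comm u 1,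
      abs_of_pos (by linarith [hu.2] : (0:ℝ) < 1 - u)] at this
  obtain ⟨p₀, hp₀⟩ := (h₀.toRFront hgf).toPP hgL hg0 hc₀
  have hI := hp₀.integral_pos hg hc₀
  set S : Set ℝ := {c | ∃ φ, IsFrontProfile f c φ} with hS
  have hSpos : ∀ c ∈ S, 0 < c := by
    rintro c ⟨φ, hφ⟩
    exact (hφ.toRFront hgf).c_pos hg hI
  have hSbdd : BddBelow S := ⟨0, fun c hc => (hSpos c hc).le⟩
  obtain ⟨cn, hanti, hlim, hmem⟩ := exists_seq_tendsto_sInf (S := S) ⟨c₀, φ₀, h₀⟩ hSbdd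
  have hpn : ∀ n, ∃ p, PP g (cn n) p := by
    intro n
    obtain ⟨φ, hφ⟩ := hmem n
    exact (hφ.toRFront hgf).toPP hgL hg0 (hSpos _ (hmem n))
  choose pn hpn using hpn
  obtain ⟨p, hp⟩ := PP.limit hg hg0 L.coe_nonneg hLr hpn (fun n => hSpos _ (hmem n)) hanti hlim
  have hc0 : 0 ≤ sInf S := Real.sInf_nonneg fun c hc => (hSpos c hc).le
  have hK : 0 < sInf S + L + 1 := by have := L.coe_nonneg; linarith
  obtain ⟨ψ, q, hψ⟩ := hp.toRFront hK (hp.le_left hLl L.coe_nonneg hc0 le_rfl)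
    (hp.le_right hLr L.coe_nonneg hc0 le_rfl)
  refine ⟨sInf S, hψ.c_pos hg hI, ⟨_, hψ.toFront hg hgf⟩, fun c hc hex => ?_⟩
  exact absurd (csInf_le hSbdd hex) (not_le.2 hc)
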